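/- Let G be a connected loopless multigraph and q odd. For r ∈ ℕ define S(r,q) = Σ over α : E(G) → 𝔽_q^* with rank of L(G,α) equal to r of η(s(α, G/W*(α))). Then S(r,q) = 0 for every odd r. -/

import Mathlib

open Finset in
/-- `u` and `v` are connected by edges in `T` (for the multigraph with origin `i`, terminus `f`). -/
def Connects {V E : Type} (i f : E → V) (T : Finset E) (u v : V) : Prop :=
  Relation.ReflTransGen
    (fun a b => ∃ e ∈ T, (i e = a ∧ f e = b) ∨ (i e = b ∧ f e = a)) u v

/-- `T` is (the edge set of) a spanning tree: connected and with `|V| - 1` edges. -/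
def IsSpanningTree {V E : Type} [Fintype V] (i f : E → V) (T : Finset E) : Prop :=
  (∀ u v : V, Connects i f T u v) ∧ T.card + 1 = Fintype.card V

/-- The spanning-tree generating polynomial `s(α, G)`. -/
noncomputable def treeSum {V E R : Type} [Fintype V] [Fintype E] [DecidableEq E]
    [CommRing R] (i f : E → V) (α : E → R) : R :=
  ∑ T ∈ @Finset.filter _ (fun T => IsSpanningTree i f T) (Classical.decPred _) Finset.univ,
    ∏ e ∈ T, α e

/-- The weighted Laplacian matrix of the multigraph. -/
def Lap {V E R : Type} [Fintype E] [DecidableEq V] [CommRing R]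
    (i f : E → V) (α : E → R) : Matrix V V R := fun k j =>
  if k = j then ∑ e ∈ Finset.univ.filter (fun e => i e = k ∨ f e = k), α e
  else - ∑ e ∈ Finset.univ.filter (fun e => (i e = k ∧ f e = j) ∨ (i e = j ∧ f e = k)), α e

/-- The projection of a vertex of `G` to a vertex of the contracted graph `G/W`. -/
def proj {V : Type} [DecidableEq V] (W : Finset V) (v : V) : Option {v : V // v ∉ W} :=
  if h : v ∈ W then none else some ⟨v, h⟩

/-- `s(α, G/W)`: the spanning-tree generating polynomial of the contraction of `W` in `G`
(the contracted graph has vertex set `Option {v // v ∉ W}`, with `none` the contracted vertex,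
and its edges are the edges of `G` not internal to `W`). -/
noncomputable def sContr {V E R : Type} [Fintype V] [Fintype E] [DecidableEq V] [DecidableEq E]
    [CommRing R] (i f : E → V) (W : Finset V) (α : E → R) : R :=
  treeSum (fun e : {e : E // ¬(i e ∈ W ∧ f e ∈ W)} => proj W (i e.1))
    (fun e => proj W (f e.1)) (fun e => α e.1)

/-- The incidence sign `ε_{v,e}`, as an element of the coefficient ring. -/
def eps {V E R : Type} [DecidableEq V] [CommRing R] (i f : E → V) (v : V) (e : E) : R :=
  if i e = v then -1 else if f e = v then 1 else 0

/-- The number of nowhere-zero `F`-flows on the multigraph. -/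
noncomputable def flowCount {V E : Type} [Fintype E] [DecidableEq V]
    (F : Type) [Field F] (i f : E → V) : ℕ :=
  Nat.card {k : E → F // (∀ e, k e ≠ 0) ∧ ∀ v : V, ∑ e : E, eps i f v e * k e = 0}

/-- The quadratic Gaussian sum `g(q)` of the finite field `F` (w.r.t. the additive
character `χ`); the quadratic character vanishes at `0`, so we may sum over all of `F`. -/
noncomputable def gSum (F : Type) [Field F] [Fintype F] [DecidableEq F]
    (χ : AddChar F ℂ) : ℂ :=
  ∑ x : F, ((quadraticChar F x : ℤ) : ℂ) * χ x

section LinearAlgebra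

open Matrix

/-- Expansion of the determinant of a product of rectangular matrices over all column choices. -/
theorem Matrix.det_mul_eq_sum_fun {n m R : Type*} [Fintype n] [DecidableEq n] [Fintype m]
    [CommRing R] (A : Matrix n m R) (B : Matrix m n R) :
    (A * B).det = ∑ p : n → m, (∏ i, A i (p i)) * (B.submatrix p id).det := by
  have h : A * B = fun i => ∑ j, A i j • B j := by
    ext i k
    simp [Matrix.mul_apply]
  rw [h]
  refine (MultilinearMap.map_sum (detRowAlternating (R := R) (n := n)).toMultilinearMap
    (fun i j => A i j • B j)).trans (Finset.sum_congr rfl fun p _ => ?_)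
  rw [MultilinearMap.map_smul_univ]
  rfl

/-- The part of the Cauchy–Binet expansion supported on a given set of columns. -/
theorem Matrix.sum_prod_mul_det_submatrix_of_image_eq {n m R : Type*} [Fintype n] [DecidableEq n]
    [Fintype m] [DecidableEq m] [CommRing R] (A : Matrix n m R) (B : Matrix m n R) {e : n → m}
    (he : Function.Injective e) :
    ∑ p : n → m with Finset.univ.image p = Finset.univ.image e,
        (∏ i, A i (p i)) * (B.submatrix p id).det =
      (A.submatrix id e).det * (B.submatrix e id).det := by
  rw [← det_transpose (A.submatrix id e), det_apply', Finset.sum_mul]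
  symm
  refine Finset.sum_bij (fun σ _ => e ∘ σ) (fun σ _ => ?_) (fun σ _ τ _ h => ?_)
    (fun p hp => ?_) (fun σ _ => ?_)
  · simp only [Finset.mem_filter, Finset.mem_univ, true_and]
    rw [← Finset.image_image, Finset.image_univ_equiv]
  · exact Equiv.ext fun i => he (congrFun h i)
  · simp only [Finset.mem_filter, Finset.mem_univ, true_and] at hp
    have hmem : ∀ i, ∃ j, e j = p i := fun i => by
      have : p i ∈ Finset.univ.image e := hp ▸ Finset.mem_image_of_mem p (Finset.mem_univ i)
      simpa using this
    choose g hg using hmem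
    have hsurj : Function.Surjective g := fun j => by
      have : e j ∈ Finset.univ.image p := hp ▸ Finset.mem_image_of_mem e (Finset.mem_univ j)
      obtain ⟨i, -, hi⟩ := Finset.mem_image.1 this
      exact ⟨i, he ((hg i).trans hi)⟩
    exact ⟨Equiv.ofBijective g (Finite.surjective_iff_bijective.1 hsurj), Finset.mem_univ _,
      funext hg⟩
  · have h : B.submatrix (e ∘ σ) id = (B.submatrix e id).submatrix σ id := rfl
    rw [h, det_permute]
    simp only [transpose_apply, submatrix_apply, id_eq, Function.comp_apply]
    ring

/-- A matrix factors through a set of rows that forms a basis of its row space. -/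
theorem Matrix.exists_eq_mul_submatrix_rows {m n K : Type*} [Finite m] [Fintype n] [Field K]
    {A : Matrix m n K} {r : ℕ} (hr : A.rank = r) :
    ∃ (I : Fin r → m) (X : Matrix m (Fin r) K),
      Function.Injective I ∧ A = X * A.submatrix I id := by
  have h := Submodule.exists_fun_fin_finrank_span_eq K (Set.range A.row)
  rw [← rank_eq_finrank_span_row, hr] at h
  obtain ⟨b, hb, hspan, hli⟩ := h
  choose I hI using hb
  have hX : ∀ k, ∃ c : Fin r → K, ∑ j, c j • b j = A.row k := fun k => by
    rw [← Submodule.mem_span_range_iff_exists_fun, hspan]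
    exact Submodule.subset_span ⟨k, rfl⟩
  choose X hX using hX
  refine ⟨I, X, fun j k h => hli.injective ?_, ?_⟩
  · rw [← hI, ← hI, h]
  · ext k v
    have h := congrFun (hX k) v
    simp only [← hI, Finset.sum_apply, Pi.smul_apply, smul_eq_mul] at h
    exact h.symm

variable {V K : Type*} [Fintype V] [Field K]

/-- A symmetric matrix has an invertible principal minor of size its rank. -/
theorem Matrix.IsSymm.exists_det_submatrix_rank_ne_zero {A : Matrix V V K} (hA : A.IsSymm)
    {r : ℕ} (hr : A.rank = r) :
    ∃ I : Fin r → V, Function.Injective I ∧ (A.submatrix I I).det ≠ 0 := by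
  obtain ⟨I, X, hI, hX⟩ := exists_eq_mul_submatrix_rows hr
  refine ⟨I, hI, ?_⟩
  have h₁ : r ≤ (A.submatrix id I).rank := by
    have h : A.submatrix id I = (A.submatrix I id)ᵀ := by
      rw [transpose_submatrix, hA.eq]
    rw [h, rank_transpose]
    calc r = (X * A.submatrix I id).rank := by rw [← hX, hr]
      _ ≤ _ := rank_mul_le_right _ _
  have h₂ : A.submatrix id I = X * A.submatrix I I := by
    conv_lhs => rw [hX]
    rfl
  have h₃ : r ≤ (A.submatrix I I).rank := by
    rw [h₂] at h₁
    exact h₁.trans (rank_mul_le_right _ _)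
  have h₄ : IsUnit (A.submatrix I I) := by
    rw [← linearIndependent_rows_iff_isUnit, linearIndependent_iff_card_eq_finrank_span,
      Fintype.card_fin, Set.finrank, ← rank_eq_finrank_span_row]
    refine le_antisymm h₃ ?_
    exact (rank_le_card_height _).trans (by simp)
  exact ((isUnit_iff_isUnit_det _).1 h₄).ne_zero

/-- The product of two principal minors of size the rank of a symmetric matrix is a square. -/
theorem Matrix.IsSymm.isSquare_det_submatrix_mul {A : Matrix V V K} (hA : A.IsSymm)
    {r : ℕ} (hr : A.rank = r) {U U' : Type*} [Fintype U] [DecidableEq U] [Fintype U'] [DecidableEq U']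
    (hU : Fintype.card U = r) (hU' : Fintype.card U' = r) (I : U → V) (J : U' → V) :
    IsSquare ((A.submatrix I I).det * (A.submatrix J J).det) := by
  obtain ⟨I₀, X, -, hX⟩ := exists_eq_mul_submatrix_rows hr
  have key : ∀ P Q : Fin r → V, (A.submatrix P Q).det =
      (X.submatrix P id).det * (A.submatrix I₀ Q).det := fun P Q => by
    rw [← det_mul]
    congr 1
    conv_lhs => rw [hX]
    rfl
  let a := (Fintype.equivFinOfCardEq hU).symm
  let b := (Fintype.equivFinOfCardEq hU').symm
  rw [← det_submatrix_equiv_self a, ← det_submatrix_equiv_self b, submatrix_submatrix,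
    submatrix_submatrix]
  have hsymm : (A.submatrix (J ∘ b) (I ∘ a)).det = (A.submatrix (I ∘ a) (J ∘ b)).det := by
    rw [← det_transpose, transpose_submatrix, hA.eq]
  refine ⟨(A.submatrix (I ∘ a) (J ∘ b)).det, ?_⟩
  nth_rewrite 2 [← hsymm]
  rw [key (I ∘ a), key (J ∘ b), key (I ∘ a), key (J ∘ b)]
  ring

end LinearAlgebra

theorem quadraticChar_eq_of_isSquare_mul {F : Type*} [Field F] [Fintype F] [DecidableEq F]
    {a b : F} (ha : a ≠ 0) (hb : b ≠ 0) (h : IsSquare (a * b)) :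
    quadraticChar F a = quadraticChar F b := by
  have h₁ := (quadraticChar_one_iff_isSquare (mul_ne_zero ha hb)).2 h
  rw [map_mul] at h₁
  rcases quadraticChar_dichotomy ha with h₂ | h₂ <;>
    rcases quadraticChar_dichotomy hb with h₃ | h₃ <;> simp_all

section MatrixTree

open Matrix

theorem Connects.symm {V E : Type} {i f : E → V} {T : Finset E} {u v : V}
    (h : Connects i f T u v) : Connects i f T v u := by
  induction h with
  | refl => exact Relation.ReflTransGen.refl
  | tail _ hbc ih =>
    obtain ⟨e, he, hbc⟩ := hbc
    exact Relation.ReflTransGen.head ⟨e, he, hbc.symm⟩ ih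

/-- The signed incidence matrix of a multigraph. -/
def incMatrix (R : Type) {V E : Type} [DecidableEq V] [CommRing R] (i f : E → V) :
    Matrix V E R :=
  fun v e => (if f e = v then 1 else 0) - (if i e = v then 1 else 0)

/-- The incidence matrix of a multigraph with the row of the root `none` removed. -/
def redIncMatrix (R : Type) {U E : Type} [DecidableEq U] [CommRing R] (i f : E → Option U) :
    Matrix U E R :=
  (incMatrix R i f).submatrix some id

theorem map_redIncMatrix {U E R : Type} [DecidableEq U] [CommRing R] (i f : E → Option U) :
    (redIncMatrix ℤ i f).map (Int.castRingHom R) = redIncMatrix R i f := by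
  ext u e
  simp only [redIncMatrix, incMatrix, map_apply, submatrix_apply, id_eq, map_sub]
  split_ifs <;> simp

theorem vecMul_incMatrix_apply {V E R : Type} [Fintype V] [DecidableEq V] [CommRing R]
    (i f : E → V) (x : V → R) (e : E) : (x ᵥ* incMatrix R i f) e = x (f e) - x (i e) := by
  simp [vecMul, dotProduct, incMatrix, mul_sub, Finset.sum_sub_distrib]

variable {U E : Type} [Fintype U] [DecidableEq U] [DecidableEq E] {i f : E → Option U}

theorem isUnit_redIncMatrix_of_connects {p : U → E}
    (h : ∀ u v, Connects i f (Finset.univ.image p) u v) :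
    IsUnit ((redIncMatrix ℤ i f).submatrix id p) := by
  rw [← mulVec_surjective_iff_isUnit]
  set M := (redIncMatrix ℤ i f).submatrix id p with hM
  let d : Option U → U → ℤ := fun v u => if v = some u then 1 else 0
  have hcol : ∀ k, M *ᵥ Pi.single k 1 = d (f (p k)) - d (i (p k)) := fun k => by
    ext u
    simp [hM, redIncMatrix, incMatrix, d]
  have hd : ∀ v, d v ∈ LinearMap.range M.mulVecLin := fun v => by
    induction h none v with
    | refl =>
      have : d none = 0 := by ext u; simp [d]
      rw [this]
      exact Submodule.zero_mem _
    | tail _ hbc ih =>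
      obtain ⟨e, he, hbc⟩ := hbc
      obtain ⟨k, -, rfl⟩ := Finset.mem_image.1 he
      have hk : d (f (p k)) - d (i (p k)) ∈ LinearMap.range M.mulVecLin :=
        ⟨Pi.single k 1, hcol k⟩
      rcases hbc with ⟨rfl, rfl⟩ | ⟨rfl, rfl⟩
      · simpa using add_mem ih hk
      · simpa using sub_mem ih hk
  intro y
  have hy : y = ∑ u, y u • d (some u) := by
    ext u
    simp [d, Finset.sum_apply]
  have : y ∈ LinearMap.range M.mulVecLin := by
    rw [hy]
    exact Submodule.sum_mem _ fun u _ => Submodule.smul_mem _ _ (hd _)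
  exact this

theorem det_redIncMatrix_of_not_connects {p : U → E}
    (h : ¬ ∀ u v, Connects i f (Finset.univ.image p) u v) :
    ((redIncMatrix ℤ i f).submatrix id p).det = 0 := by
  classical
  set C : Option U → Prop := Connects i f (Finset.univ.image p) none with hC
  have hw : ∃ w, ¬ C w := by
    by_contra! hall
    exact h fun u v => (hall u).symm.trans (hall v)
  obtain ⟨w, hw⟩ := hw
  let X : Option U → ℤ := fun v => if C v then 0 else 1
  have hX0 : X none = 0 := if_pos Relation.ReflTransGen.refl
  rw [← exists_vecMul_eq_zero_iff]
  refine ⟨fun u => X (some u), fun h0 => ?_, ?_⟩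
  · cases w with
    | none => exact hw Relation.ReflTransGen.refl
    | some u => simpa [X, hw] using congrFun h0 u
  · ext k
    have hred : ((fun u => X (some u)) ᵥ* (redIncMatrix ℤ i f).submatrix id p) k =
        (X ᵥ* incMatrix ℤ i f) (p k) := by
      simp [vecMul, dotProduct, Fintype.sum_option, hX0, redIncMatrix]
    have hstep : C (i (p k)) ↔ C (f (p k)) := by
      have hk : p k ∈ Finset.univ.image p := Finset.mem_image_of_mem p (Finset.mem_univ k)
      exact ⟨fun h => h.tail ⟨p k, hk, Or.inl ⟨rfl, rfl⟩⟩,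
        fun h => h.tail ⟨p k, hk, Or.inr ⟨rfl, rfl⟩⟩⟩
    rw [hred, vecMul_incMatrix_apply]
    simp [X, hstep]

variable {R : Type} [CommRing R]

theorem det_redIncMatrix_sq (p : U → E)
    [Decidable (∀ u v, Connects i f (Finset.univ.image p) u v)] :
    ((redIncMatrix R i f).submatrix id p).det ^ 2 =
      if ∀ u v, Connects i f (Finset.univ.image p) u v then 1 else 0 := by
  have hcast : ((redIncMatrix R i f).submatrix id p).det =
      ((((redIncMatrix ℤ i f).submatrix id p).det : ℤ) : R) := by
    rw [← map_redIncMatrix, ← eq_intCast (Int.castRingHom R), RingHom.map_det]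
    rfl
  rw [hcast]
  split_ifs with h
  · have hu := (isUnit_iff_isUnit_det _).1 (isUnit_redIncMatrix_of_connects h)
    rcases Int.isUnit_iff.1 hu with h | h <;> simp [h]
  · simp [det_redIncMatrix_of_not_connects h]

/-- The weighted matrix-tree theorem for a multigraph rooted at `none`. -/
theorem det_redIncMatrix_mul_diagonal_mul_transpose [Fintype E] (i f : E → Option U) (α : E → R) :
    (redIncMatrix R i f * (diagonal α * (redIncMatrix R i f)ᵀ)).det = treeSum i f α := by
  classical
  rw [det_mul_eq_sum_fun, treeSum, Finset.sum_filter,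
    ← Finset.sum_fiberwise Finset.univ (fun p : U → E => Finset.univ.image p)]
  refine Finset.sum_congr rfl fun S _ => ?_
  have hopt : ∀ n : ℕ, n + 1 = Fintype.card (Option U) ↔ n = Fintype.card U := by
    simp [Fintype.card_option]
  by_cases hS : S.card = Fintype.card U
  · have hcard : Fintype.card U = Fintype.card S := by simp [hS]
    let e := Fintype.equivOfCardEq hcard
    have hinj : Function.Injective fun u => (e u : E) :=
      Subtype.val_injective.comp e.injective
    obtain ⟨p, hp, rfl⟩ : ∃ p : U → E, Function.Injective p ∧ Finset.univ.image p = S := by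
      refine ⟨_, hinj, ?_⟩
      ext x
      simp only [Finset.mem_image, Finset.mem_univ, true_and]
      exact ⟨fun ⟨u, hu⟩ => hu ▸ (e u).2, fun hx => ⟨e.symm ⟨x, hx⟩, by simp⟩⟩
    have hB : ((diagonal α * (redIncMatrix R i f)ᵀ).submatrix p id).det =
        (∏ u, α (p u)) * ((redIncMatrix R i f).submatrix id p).det := by
      rw [← det_transpose ((redIncMatrix R i f).submatrix id p), ← det_mul_column]
      congr 1
      ext u v
      simp [diagonal_mul]
    rw [sum_prod_mul_det_submatrix_of_image_eq _ _ hp, hB, Finset.prod_image fun _ _ _ _ h => hp h]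
    have hsq := det_redIncMatrix_sq (R := R) (i := i) (f := f) p
    have hT : IsSpanningTree i f (Finset.univ.image p) ↔
        ∀ u v, Connects i f (Finset.univ.image p) u v := by
      rw [IsSpanningTree, hopt]
      exact and_iff_left hS
    rw [mul_left_comm, ← sq, hsq]
    simp only [hT]
    split_ifs <;> simp
  · rw [if_neg fun h => hS ((hopt _).1 h.2)]
    refine Finset.sum_eq_zero fun p hp => ?_
    have hp := (Finset.mem_filter.1 hp).2
    have hni : ¬ Function.Injective p := fun hinj => hS <| by
      rw [← hp, Finset.card_image_of_injective _ hinj, Finset.card_univ]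
    simp only [Function.Injective, not_forall] at hni
    obtain ⟨a, b, hab, hne⟩ := hni
    rw [det_zero_of_row_eq hne, mul_zero]
    ext v
    simp [hab]

end MatrixTree

section Laplacian

open Matrix

variable {V E R : Type} [Fintype E] [DecidableEq V] [CommRing R]
  {i f : E → V}

theorem Lap_apply_eq_sum (hl : ∀ e, i e ≠ f e) (α : E → R) (k j : V) :
    Lap i f α k j = ∑ e, incMatrix R i f k e * (α e * incMatrix R i f j e) := by
  unfold Lap
  split_ifs with h
  · subst h
    rw [Finset.sum_filter]
    refine Finset.sum_congr rfl fun e _ => ?_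
    have := hl e
    by_cases h₁ : i e = k <;> by_cases h₂ : f e = k <;> simp_all [incMatrix]
  · rw [Finset.sum_filter, ← Finset.sum_neg_distrib]
    refine Finset.sum_congr rfl fun e _ => ?_
    have := hl e
    by_cases h₁ : i e = k <;> by_cases h₂ : f e = k <;> by_cases h₃ : i e = j <;>
      by_cases h₄ : f e = j <;> simp_all [incMatrix]

theorem Lap_eq_incMatrix_mul [DecidableEq E] (hl : ∀ e, i e ≠ f e) (α : E → R) :
    Lap i f α = incMatrix R i f * (diagonal α * (incMatrix R i f)ᵀ) := by
  ext k j
  simp only [Lap_apply_eq_sum hl, mul_apply (M := incMatrix R i f), diagonal_mul, transpose_apply]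

theorem Lap_isSymm (hl : ∀ e, i e ≠ f e) (α : E → R) : (Lap i f α).IsSymm := by
  ext k j
  rw [transpose_apply, Lap_apply_eq_sum hl, Lap_apply_eq_sum hl]
  exact Finset.sum_congr rfl fun e _ => by ring

theorem Lap_mul_left (c : R) (α : E → R) : Lap i f (fun e => c * α e) = c • Lap i f α := by
  ext k j
  simp only [Lap, Matrix.smul_apply, smul_eq_mul]
  split_ifs <;> simp [Finset.mul_sum]

theorem proj_eq_some_iff {W : Finset V} {x : V} {u : {v : V // v ∉ W}} :
    proj W x = some u ↔ x = u := by
  unfold proj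
  split_ifs with h
  · simp only [false_iff]
    rintro rfl
    exact u.2 h
  · simp [Subtype.ext_iff]

variable [Fintype V]

theorem det_Lap [DecidableEq E] [Nonempty V] [IsDomain R] (hl : ∀ e, i e ≠ f e) (α : E → R) :
    (Lap i f α).det = 0 := by
  rw [← exists_vecMul_eq_zero_iff]
  refine ⟨1, one_ne_zero, ?_⟩
  have h : (1 : V → R) ᵥ* incMatrix R i f = 0 := by
    ext e
    simp [vecMul_incMatrix_apply]
  rw [Lap_eq_incMatrix_mul hl, ← vecMul_vecMul, h, zero_vecMul]

theorem rank_Lap_lt [DecidableEq E] {K : Type} [Field K] [Nonempty V]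
    (hl : ∀ e, i e ≠ f e) (α : E → K) :
    (Lap i f α).rank < Fintype.card V := by
  refine lt_of_le_of_ne (rank_le_card_height _) fun h => ?_
  have hu : IsUnit (Lap i f α) := by
    rw [← linearIndependent_rows_iff_isUnit, linearIndependent_iff_card_eq_finrank_span,
      Set.finrank, ← rank_eq_finrank_span_row, h]
  exact ((isUnit_iff_isUnit_det _).1 hu).ne_zero (det_Lap hl α)

/-- The matrix-tree theorem for contractions: `s(α, G/W)` is the principal minor of the weighted
Laplacian on the complement of `W`. -/
theorem sContr_eq_det_submatrix [DecidableEq E] (hl : ∀ e, i e ≠ f e) (W : Finset V) (α : E → R) :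
    sContr i f W α =
      ((Lap i f α).submatrix (Subtype.val : {v // v ∉ W} → V) Subtype.val).det := by
  rw [sContr, ← det_redIncMatrix_mul_diagonal_mul_transpose]
  congr 1
  ext u v
  simp only [submatrix_apply, Lap_apply_eq_sum hl,
    mul_apply (M := redIncMatrix R _ _), diagonal_mul, transpose_apply]
  have hinc : ∀ (w : {v // v ∉ W}) (e : {e : E // ¬(i e ∈ W ∧ f e ∈ W)}),
      redIncMatrix R (fun e : {e : E // ¬(i e ∈ W ∧ f e ∈ W)} => proj W (i e.1))
        (fun e => proj W (f e.1)) w e = incMatrix R i f w e := fun w e => by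
    simp [redIncMatrix, incMatrix, proj_eq_some_iff]
  simp only [hinc]
  rw [← Finset.sum_subtype (Finset.univ.filter fun e => ¬(i e ∈ W ∧ f e ∈ W)) (by simp)
    fun e => incMatrix R i f u e * (α e * incMatrix R i f v e)]
  refine Finset.sum_filter_of_ne fun e _ he hW => he ?_
  have hf : f e ≠ u := fun h => u.2 (h ▸ hW.2)
  have hi : i e ≠ u := fun h => u.2 (h ▸ hW.1)
  simp [incMatrix, hf, hi]

end Laplacian

/-- A vertex set of minimal cardinality with nonvanishing `s(α, G/W)` leaves `rank L(α)` vertices. -/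
theorem card_add_rank_Lap_eq {V E K : Type} [Fintype V] [Fintype E] [DecidableEq V]
    [DecidableEq E] [Field K] {i f : E → V} (hl : ∀ e, i e ≠ f e) {α : E → K} {W : Finset V}
    (hne : W.Nonempty) (hW : sContr i f W α ≠ 0)
    (hmin : ∀ W' : Finset V, W'.Nonempty → sContr i f W' α ≠ 0 → W.card ≤ W'.card) :
    Fintype.card {v // v ∉ W} = (Lap i f α).rank := by
  have : Nonempty V := ⟨hne.choose⟩
  have hcard : Fintype.card {v // v ∉ W} = Fintype.card V - W.card := by
    simp [Fintype.card_subtype_compl]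
  refine le_antisymm ?_ ?_
  · rw [sContr_eq_det_submatrix hl] at hW
    rw [← Matrix.rank_of_det_ne_zero hW]
    exact Matrix.rank_submatrix_le _ _ _
  · obtain ⟨I, hI, hdet⟩ := (Lap_isSymm hl α).exists_det_submatrix_rank_ne_zero rfl
    have hlt := rank_Lap_lt hl α
    set W' : Finset V := (Finset.univ.image I)ᶜ with hW'
    have hcard' : W'.card = Fintype.card V - (Lap i f α).rank := by
      rw [hW', Finset.card_compl, Finset.card_image_of_injective _ hI, Finset.card_univ,
        Fintype.card_fin]
    have hne' : W'.Nonempty := by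
      rw [← Finset.card_pos]
      omega
    have hdet' : sContr i f W' α ≠ 0 := by
      rw [sContr_eq_det_submatrix hl]
      let e : Fin (Lap i f α).rank ≃ {v // v ∉ W'} :=
        Equiv.ofBijective (fun k => ⟨I k, by simp [hW']⟩)
          ⟨fun k l h => hI (congrArg Subtype.val h), fun ⟨v, hv⟩ => by
            obtain ⟨k, hk⟩ : ∃ k, I k = v := by simpa [hW'] using hv
            exact ⟨k, Subtype.ext hk⟩⟩
      rw [← Matrix.det_submatrix_equiv_self e]
      exact hdet
    have := hmin W' hne' hdet'
    omega

/-- The terms of the main formula with odd Laplacian rank cancel: `S(r, q) = 0` for odd `r`. -/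
theorem sum_quadraticChar_sContr_eq_zero_of_odd {V E F : Type} [Fintype V] [Fintype E]
    [DecidableEq V] [DecidableEq E] [Field F] [Fintype F] [DecidableEq F]
    (hF : ringChar F ≠ 2)
    (i f : E → V) (hl : ∀ e : E, i e ≠ f e)
    (hconn : ∀ u v : V, Connects i f Finset.univ u v)
    (Wstar : (E → Fˣ) → Finset V)
    (hW : ∀ α : E → Fˣ, (Wstar α).Nonempty ∧
      sContr i f (Wstar α) (fun e => (α e : F)) ≠ 0 ∧
      ∀ W : Finset V, W.Nonempty → sContr i f W (fun e => (α e : F)) ≠ 0 →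
        (Wstar α).card ≤ W.card)
    (r : ℕ) (hr : Odd r) :
    ∑ α ∈ @Finset.filter _
        (fun α : E → Fˣ => (Lap i f (fun e => ((α e : F)))).rank = r)
        (Classical.decPred _) Finset.univ,
      quadraticChar F (sContr i f (Wstar α) (fun e => (α e : F))) = 0 := by
  classical
  obtain ⟨c, hc⟩ := FiniteField.exists_nonsquare hF
  have hc0 : c ≠ 0 := fun h => hc (h ▸ IsSquare.zero)
  let γ : E → Fˣ := fun _ => Units.mk0 c hc0
  have hLap : ∀ α : E → Fˣ, Lap i f (fun e => ((γ * α) e : F)) =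
      c • Lap i f (fun e => (α e : F)) := fun α => by
    rw [← Lap_mul_left]
    rfl
  have hrank : ∀ α : E → Fˣ, (Lap i f (fun e => ((γ * α) e : F))).rank =
      (Lap i f (fun e => (α e : F))).rank := fun α => by
    rw [hLap, Matrix.rank_smul_of_mem_nonZeroDivisors _ (mem_nonZeroDivisors_of_ne_zero hc0)]
  have hcard : ∀ α : E → Fˣ, Fintype.card {v // v ∉ Wstar α} =
      (Lap i f (fun e => (α e : F))).rank := fun α =>
    card_add_rank_Lap_eq hl (hW α).1 (hW α).2.1 (hW α).2.2
  have hterm : ∀ α : E → Fˣ, (Lap i f (fun e => (α e : F))).rank = r →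
      quadraticChar F (sContr i f (Wstar (γ * α)) (fun e => ((γ * α) e : F))) =
        -quadraticChar F (sContr i f (Wstar α) (fun e => (α e : F))) := fun α hα => by
    have hα' := hcard (γ * α)
    rw [hrank, hα] at hα'
    have h₁ := (hW α).2.1
    have h₂ := (hW (γ * α)).2.1
    rw [sContr_eq_det_submatrix hl] at h₁ h₂ ⊢
    rw [sContr_eq_det_submatrix hl]
    rw [hLap, Matrix.submatrix_smul, Pi.smul_apply, Pi.smul_apply, Matrix.det_smul, hα'] at h₂ ⊢
    rw [map_mul, map_pow, quadraticChar_neg_one_iff_not_isSquare.2 hc, hr.neg_one_pow,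
      neg_one_mul, neg_inj]
    exact quadraticChar_eq_of_isSquare_mul (right_ne_zero_of_mul h₂) h₁
      ((Lap_isSymm hl _).isSquare_det_submatrix_mul hα hα' ((hcard α).trans hα) _ _)
  refine self_eq_neg.1 ?_
  rw [← Finset.sum_neg_distrib]
  refine (Finset.sum_equiv (Equiv.mulLeft γ) (fun α => ?_) fun α hα => ?_).symm
  · simp only [Finset.mem_filter, Finset.mem_univ, true_and, Equiv.coe_mulLeft, hrank]
  · exact (hterm α (by simpa using hα)).symm
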